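/- For every x ∈ (0, 1/3), the integral (1/12) · ∫_{R₁(x)} V(t₁,t₂,t₃) · Ĩ₁(x,t) dt₁dt₂dt₃ over the region R₁(x) = { t ∈ ℝ³ : t₁,t₂,t₃ ≥ 0, t₁+t₂+t₃ ≤ 1, 3t₁+t₂+t₃/3 ≤ 1, |t₁ − t₃/3| ≥ x } equals x·(3x−1)⁹·(567x⁴ − 3564x³ + 5526x² − 3152x − 1345) / 387370509926400. -/

import Mathlib

open MeasureTheory

/-- `V(t₁,t₂,t₃)`. -/
noncomputable def Vpoly (t : ℝ × ℝ × ℝ) : ℝ :=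
  t.1 * t.2.1 * t.2.2 * (2 * t.1 + t.2.1) * (3 * t.2.1 + 2 * t.2.2)
    * (6 * t.1 + 3 * t.2.1 + 2 * t.2.2) / 432

/-- `Ĩ₁(x, t)`. -/
noncomputable def Itilde1 (x : ℝ) (t : ℝ × ℝ × ℝ) : ℝ :=
  t.2.1 * (t.1 + t.2.1 / 2 + t.2.2 / 3) / 32 * (|t.1 - t.2.2 / 3| - x) ^ 2 * x

/-- The region `R₁(x)`. -/
def Rregion1 (x : ℝ) : Set (ℝ × ℝ × ℝ) :=
  {t | 0 ≤ t.1 ∧ 0 ≤ t.2.1 ∧ 0 ≤ t.2.2 ∧ t.1 + t.2.1 + t.2.2 ≤ 1 ∧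
    3 * t.1 + t.2.1 + t.2.2 / 3 ≤ 1 ∧ x ≤ |t.1 - t.2.2 / 3|}

section Subgraph

variable {X : Type*} [TopologicalSpace X] {K : Set X} {g : X → ℝ}

theorem isCompact_closed_subgraph [T2Space X] (hK : IsCompact K) (hg : Continuous g) :
    IsCompact {p : X × ℝ | p.1 ∈ K ∧ 0 ≤ p.2 ∧ p.2 ≤ g p.1} := by
  obtain ⟨M, hM⟩ := hK.bddAbove_image hg.continuousOn
  refine (hK.prod (isCompact_Icc (a := (0 : ℝ)) (b := M))).of_isClosed_subset ?_ ?_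
  · exact (hK.isClosed.preimage continuous_fst).inter
      ((isClosed_le continuous_const continuous_snd).inter
        (isClosed_le continuous_snd (hg.comp continuous_fst)))
  · rintro ⟨p, y⟩ ⟨hp, h0, hy⟩
    exact ⟨hp, h0, hy.trans (hM ⟨p, hp, rfl⟩)⟩

/-- Fubini theorem over the closed region under the graph of a nonnegative function. -/
theorem setIntegral_closed_subgraph [T2Space X] [SecondCountableTopology X]
    [MeasurableSpace X] [BorelSpace X] {μ : Measure X} [SFinite μ]
    [IsFiniteMeasureOnCompacts (μ.prod (volume : Measure ℝ))]
    (hK : IsCompact K) (hg : Continuous g) (hg0 : ∀ p ∈ K, 0 ≤ g p)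
    {f : X × ℝ → ℝ} (hf : Continuous f) :
    ∫ p in {p : X × ℝ | p.1 ∈ K ∧ 0 ≤ p.2 ∧ p.2 ≤ g p.1}, f p ∂(μ.prod volume)
      = ∫ p in K, (∫ y in 0..g p, f (p, y)) ∂μ := by
  set S := {p : X × ℝ | p.1 ∈ K ∧ 0 ≤ p.2 ∧ p.2 ≤ g p.1} with hSdef
  have hS : IsCompact S := isCompact_closed_subgraph hK hg
  have hint : IntegrableOn f S (μ.prod volume) := hf.continuousOn.integrableOn_compact hS
  rw [← integral_indicator hS.measurableSet,
    integral_prod _ (hint.integrable_indicator hS.measurableSet),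
    ← integral_indicator hK.measurableSet]
  congr 1
  funext p
  by_cases hp : p ∈ K
  · rw [Set.indicator_of_mem hp, intervalIntegral.integral_of_le (hg0 p hp),
      ← integral_Icc_eq_integral_Ioc, ← integral_indicator measurableSet_Icc]
    congr 1
    funext y
    simp [Set.indicator, hSdef, hp]
  · simp [Set.indicator, hSdef, hp]

end Subgraph

/-- Iterated integral over a region in `ℝ³` bounded by graphs. -/
theorem setIntegral_iterated {α β : ℝ} (hαβ : α ≤ β) {g : ℝ → ℝ} {h : ℝ × ℝ → ℝ}
    (hg : Continuous g) (hh : Continuous h) (hg0 : ∀ u ∈ Set.Icc α β, 0 ≤ g u)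
    (hh0 : ∀ p : ℝ × ℝ, p.1 ∈ Set.Icc α β → 0 ≤ p.2 → p.2 ≤ g p.1 → 0 ≤ h p)
    {f : (ℝ × ℝ) × ℝ → ℝ} (hf : Continuous f) {F : ℝ × ℝ → ℝ} (hF : Continuous F)
    (hfF : ∀ p, ∫ b in 0..h p, f (p, b) = F p) :
    ∫ q in {q : (ℝ × ℝ) × ℝ | (q.1.1 ∈ Set.Icc α β ∧ 0 ≤ q.1.2 ∧ q.1.2 ≤ g q.1.1) ∧
        0 ≤ q.2 ∧ q.2 ≤ h q.1}, f q
      = ∫ u in α..β, ∫ s in 0..g u, F (u, s) := by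
  have houter := setIntegral_closed_subgraph (μ := (volume : Measure (ℝ × ℝ)))
    (isCompact_closed_subgraph (isCompact_Icc (a := α) (b := β)) hg) hh
    (fun p hp => hh0 p hp.1 hp.2.1 hp.2.2) hf
  refine houter.trans ?_
  simp only [hfF]
  rw [Measure.volume_eq_prod, setIntegral_closed_subgraph isCompact_Icc hg hg0 hF,
    integral_Icc_eq_integral_Ioc, ← intervalIntegral.integral_of_le hαβ]

theorem integral_sum_mul_pow {n : ℕ} (c : Fin n → ℝ) (M : ℝ) :
    ∫ t in 0..M, ∑ k, c k * t ^ (k : ℕ) = ∑ k, c k * (M ^ (k + 1 : ℕ) / (k + 1)) := by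
  rw [intervalIntegral.integral_finsetSum
    fun k _ => (by fun_prop : Continuous _).intervalIntegrable _ _]
  simp

/-- The integral over `b ∈ [0, M]` of the `b`-dependent part of the integrand. -/
noncomputable def innerPrimitive (a s M : ℝ) : ℝ :=
  1 / 7 * M ^ 7 + s * M ^ 6 + 12 / 5 * s ^ 2 * M ^ 5 + 2 * s ^ 3 * M ^ 4 + a * M ^ 6 +
    28 / 5 * a * s * M ^ 5 + 10 * a * s ^ 2 * M ^ 4 + 16 / 3 * a * s ^ 3 * M ^ 3 +
    12 / 5 * a ^ 2 * M ^ 5 + 10 * a ^ 2 * s * M ^ 4 + 32 / 3 * a ^ 2 * s ^ 2 * M ^ 3 +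
    2 * a ^ 3 * M ^ 4 + 16 / 3 * a ^ 3 * s * M ^ 3

theorem integral_eq_innerPrimitive (a s M : ℝ) :
    ∫ b in 0..M, b ^ 2 * (2 * a + b) * (2 * s + b) * (2 * a + 2 * s + b) ^ 2
      = innerPrimitive a s M := by
  have h := integral_sum_mul_pow
    (![0, 0, 16 * a * s ^ 3 + 32 * a ^ 2 * s ^ 2 + 16 * a ^ 3 * s, 8 * s ^ 3 +
      40 * a * s ^ 2 + 40 * a ^ 2 * s + 8 * a ^ 3, 12 * s ^ 2 + 28 * a * s + 12 * a ^ 2,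
      6 * s + 6 * a, 1] : Fin 7 → ℝ) M
  simp only [Fin.sum_univ_succ, Fin.sum_univ_zero] at h
  simp at h
  refine Eq.trans ?_ (h.trans ?_)
  · congr 1
    funext b
    ring
  · unfold innerPrimitive
    ring

theorem integral_middle (u w : ℝ) :
    ∫ s in 0..w / 4, s * (u + s) * innerPrimitive (u + s) s (w - 4 * s)
      = 1 / 33600 * w ^ 10 + 1 / 1680 * u * w ^ 9 + 11 / 3360 * u ^ 2 * w ^ 8 +
        1 / 140 * u ^ 3 * w ^ 7 + 1 / 180 * u ^ 4 * w ^ 6 := by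
  have h := integral_sum_mul_pow
    (![0, 1 / 7 * u * w ^ 7 + u ^ 2 * w ^ 6 + 12 / 5 * u ^ 3 * w ^ 5 + 2 * u ^ 4 * w ^ 4,
      1 / 7 * w ^ 7 - u * w ^ 6 - 56 / 5 * u ^ 2 * w ^ 5 - 30 * u ^ 3 * w ^ 4 -
      80 / 3 * u ^ 4 * w ^ 3, -2 * w ^ 6 - 16 / 5 * u * w ^ 5 + 36 * u ^ 2 * w ^ 4 +
      128 * u ^ 3 * w ^ 3 + 128 * u ^ 4 * w ^ 2, 52 / 5 * w ^ 5 + 44 * u * w ^ 4 +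
      16 / 3 * u ^ 2 * w ^ 3 - 192 * u ^ 3 * w ^ 2 - 256 * u ^ 4 * w, -24 * w ^ 4 -
      128 * u * w ^ 3 - 192 * u ^ 2 * w ^ 2 + 512 / 3 * u ^ 4, 64 / 3 * w ^ 3 +
      128 * u * w ^ 2 + 256 * u ^ 2 * w + 512 / 5 * u ^ 3, -2048 / 15 * u ^ 2,
      -3072 / 35 * u, -2048 / 105] : Fin 10 → ℝ) (w / 4)
  simp only [Fin.sum_univ_succ, Fin.sum_univ_zero] at h
  simp at h
  refine Eq.trans ?_ (h.trans ?_)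
  · congr 1
    funext s
    unfold innerPrimitive
    ring
  · ring

/-- `integral_middle` along the slice `w = 1 - 3 * u`. -/
noncomputable def sliceWeight (w : ℝ) : ℝ :=
  1 / 14580 * w ^ 6 - 1 / 102060 * w ^ 7 - 1 / 54432 * w ^ 8 - 1 / 102060 * w ^ 9 -
    1 / 1166400 * w ^ 10

theorem integral_slice (w : ℝ) :
    ∫ s in 0..w / 4, s * ((1 - w) / 3 + s) * innerPrimitive ((1 - w) / 3 + s) s (w - 4 * s)
      = sliceWeight w := by
  rw [integral_middle]
  unfold sliceWeight
  ring

theorem integral_outer (y : ℝ) :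
    ∫ w in 0..y, (y - w) ^ 2 * sliceWeight w
      = 1 / 3674160 * y ^ 9 - 1 / 36741600 * y ^ 10 - 1 / 26943840 * y ^ 11 -
        1 / 67359600 * y ^ 12 - 1 / 1000771200 * y ^ 13 := by
  have h := integral_sum_mul_pow
    (![0, 0, 0, 0, 0, 0, 1 / 14580 * y ^ 2, -1 / 7290 * y - 1 / 102060 * y ^ 2, 1 / 14580 +
      1 / 51030 * y - 1 / 54432 * y ^ 2, -1 / 102060 + 1 / 27216 * y - 1 / 102060 * y ^ 2,
      -1 / 54432 + 1 / 51030 * y - 1 / 1166400 * y ^ 2, -1 / 102060 + 1 / 583200 * y,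
      -1 / 1166400] : Fin 13 → ℝ) y
  simp only [Fin.sum_univ_succ, Fin.sum_univ_zero] at h
  simp at h
  refine Eq.trans ?_ (h.trans ?_)
  · congr 1
    funext w
    unfold sliceWeight
    ring
  · ring

theorem continuous_innerPrimitive {X : Type*} [TopologicalSpace X] {a s M : X → ℝ}
    (ha : Continuous a) (hs : Continuous s) (hM : Continuous M) :
    Continuous fun p => innerPrimitive (a p) (s p) (M p) := by
  unfold innerPrimitive
  fun_prop

theorem measurePreserving_shear_fst :
    MeasurePreserving (fun q : (ℝ × ℝ) × ℝ => (q.1.1 + q.1.2 / 3, (q.2, q.1.2))) := by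
  have hshear : MeasurePreserving
      (fun p : (ℝ × ℝ) × ℝ => (Prod.swap p.1, p.2 + p.1.1 / 3))
      ((volume : Measure (ℝ × ℝ)).prod volume) ((volume : Measure (ℝ × ℝ)).prod volume) :=
    (Measure.measurePreserving_swap (μ := (volume : Measure ℝ))
      (ν := (volume : Measure ℝ))).skew_product (g := fun p t => t + p.1 / 3) (by fun_prop)
      (.of_forall fun p => (measurePreserving_add_right volume (p.1 / 3)).map_eq)
  exact (Measure.measurePreserving_swap.comp hshear).comp
    (Measure.measurePreserving_swap.comp volume_preserving_prodAssoc)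

theorem measurePreserving_shear_snd :
    MeasurePreserving (fun q : (ℝ × ℝ) × ℝ => (q.1.2, (q.2, q.1.1 + 3 * q.1.2))) := by
  have hshear : MeasurePreserving
      (fun p : (ℝ × ℝ) × ℝ => (p.1, p.2 + 3 * p.1.1))
      ((volume : Measure (ℝ × ℝ)).prod volume) ((volume : Measure (ℝ × ℝ)).prod volume) :=
    (MeasurePreserving.id (volume : Measure (ℝ × ℝ))).skew_product
      (g := fun p t => t + 3 * p.1) (by fun_prop)
      (.of_forall fun p => (measurePreserving_add_right volume (3 * p.1)).map_eq)
  exact (volume_preserving_prodAssoc.comp hshear).comp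
    (Measure.measurePreserving_swap.comp volume_preserving_prodAssoc)

/-- The part of `Rregion1 x` on which `t₁ ≥ t₃ / 3`. -/
def upperRegion (x : ℝ) : Set (ℝ × ℝ × ℝ) :=
  {t | 0 ≤ t.1 ∧ 0 ≤ t.2.1 ∧ 0 ≤ t.2.2 ∧ 3 * t.1 + t.2.1 + t.2.2 / 3 ≤ 1 ∧ x ≤ t.1 - t.2.2 / 3}

/-- The part of `Rregion1 x` on which `t₁ ≤ t₃ / 3`. -/
def lowerRegion (x : ℝ) : Set (ℝ × ℝ × ℝ) :=
  {t | 0 ≤ t.1 ∧ 0 ≤ t.2.1 ∧ 0 ≤ t.2.2 ∧ t.1 + t.2.1 + t.2.2 ≤ 1 ∧ x ≤ t.2.2 / 3 - t.1}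

theorem measurableSet_upperRegion (x : ℝ) : MeasurableSet (upperRegion x) := by
  unfold upperRegion
  measurability

theorem measurableSet_lowerRegion (x : ℝ) : MeasurableSet (lowerRegion x) := by
  unfold lowerRegion
  measurability

theorem Rregion1_eq_union {x : ℝ} (hx : 0 < x) :
    Rregion1 x = upperRegion x ∪ lowerRegion x := by
  ext ⟨a, b, c⟩
  simp only [Rregion1, upperRegion, lowerRegion, Set.mem_ofPred_eq, Set.mem_union, le_abs]
  constructor
  · rintro ⟨ha, hb, hc, h1, h2, h | h⟩
    · exact Or.inl ⟨ha, hb, hc, h2, h⟩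
    · exact Or.inr ⟨ha, hb, hc, h1, by linarith⟩
  · rintro (⟨ha, hb, hc, h1, h⟩ | ⟨ha, hb, hc, h1, h⟩)
    · exact ⟨ha, hb, hc, by linarith, h1, Or.inl h⟩
    · exact ⟨ha, hb, hc, h1, by linarith, Or.inr (by linarith)⟩

theorem disjoint_upperRegion_lowerRegion {x : ℝ} (hx : 0 < x) :
    Disjoint (upperRegion x) (lowerRegion x) := by
  rw [Set.disjoint_left]
  rintro t ⟨-, -, -, -, h⟩ ⟨-, -, -, -, h'⟩
  linarith

theorem continuous_integrand (x : ℝ) : Continuous fun t => Vpoly t * Itilde1 x t := by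
  unfold Vpoly Itilde1
  fun_prop

theorem integrableOn_Rregion1 (x : ℝ) :
    IntegrableOn (fun t => Vpoly t * Itilde1 x t) (Rregion1 x) := by
  refine ((continuous_integrand x).continuousOn.integrableOn_compact
    (isCompact_Icc (a := ((0, 0, 0) : ℝ × ℝ × ℝ)) (b := (1, 1, 1)))).mono_set ?_
  rintro ⟨a, b, c⟩ ⟨ha, hb, hc, h, -⟩
  simp only at ha hb hc h
  exact ⟨⟨ha, hb, hc⟩, by simp only; linarith, by simp only; linarith, by simp only; linarith⟩

theorem integral_sum_regions {x : ℝ} (hx : 0 < x) :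
    ∫ t in Rregion1 x, Vpoly t * Itilde1 x t
      = (∫ t in upperRegion x, Vpoly t * Itilde1 x t)
        + ∫ t in lowerRegion x, Vpoly t * Itilde1 x t := by
  have h := integrableOn_Rregion1 x
  rw [Rregion1_eq_union hx] at h ⊢
  exact setIntegral_union (disjoint_upperRegion_lowerRegion hx) (measurableSet_lowerRegion x)
    h.left_of_union h.right_of_union

theorem integral_upperRegion {x : ℝ} (hx0 : 0 < x) (hx1 : x < 1 / 3) :
    ∫ t in upperRegion x, Vpoly t * Itilde1 x t
      = x / 9216 * ∫ w in 0..1 - 3 * x, (1 - 3 * x - w) ^ 2 * sliceWeight w := by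
  have hemb : MeasurableEmbedding
      (fun q : (ℝ × ℝ) × ℝ => (q.1.1 + q.1.2 / 3, (q.2, q.1.2))) := by
    refine Continuous.measurableEmbedding (by fun_prop) ?_
    rintro ⟨⟨u, c⟩, b⟩ ⟨⟨u', c'⟩, b'⟩ h
    simp only [Prod.mk.injEq] at h ⊢
    obtain ⟨h1, h2, h3⟩ := h
    exact ⟨⟨by linarith, h3⟩, h2⟩
  rw [← measurePreserving_shear_fst.setIntegral_preimage_emb hemb]
  have hset : (fun q : (ℝ × ℝ) × ℝ => (q.1.1 + q.1.2 / 3, (q.2, q.1.2))) ⁻¹' upperRegion x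
      = {q | (q.1.1 ∈ Set.Icc x (1 / 3) ∧ 0 ≤ q.1.2 ∧ q.1.2 ≤ 3 * ((1 - 3 * q.1.1) / 4)) ∧
        0 ≤ q.2 ∧ q.2 ≤ 1 - 3 * q.1.1 - 4 * (q.1.2 / 3)} := by
    ext ⟨⟨u, c⟩, b⟩
    simp only [upperRegion, Set.mem_preimage, Set.mem_ofPred_eq, Set.mem_Icc]
    constructor
    · rintro ⟨h1, h2, h3, h4, h5⟩
      refine ⟨⟨⟨?_, ?_⟩, ?_, ?_⟩, ?_, ?_⟩ <;> linarith
    · rintro ⟨⟨⟨h1, h2⟩, h3, h4⟩, h5, h6⟩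
      refine ⟨?_, ?_, ?_, ?_, ?_⟩ <;> linarith
  have hcongr : Set.EqOn
      (fun q : (ℝ × ℝ) × ℝ => Vpoly (q.1.1 + q.1.2 / 3, (q.2, q.1.2))
        * Itilde1 x (q.1.1 + q.1.2 / 3, (q.2, q.1.2)))
      (fun q => x / 1024 * (q.1.1 - x) ^ 2 * (q.1.2 / 3 * (q.1.1 + q.1.2 / 3)) *
        (q.2 ^ 2 * (2 * (q.1.1 + q.1.2 / 3) + q.2) * (2 * (q.1.2 / 3) + q.2) *
          (2 * (q.1.1 + q.1.2 / 3) + 2 * (q.1.2 / 3) + q.2) ^ 2))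
      ((fun q : (ℝ × ℝ) × ℝ => (q.1.1 + q.1.2 / 3, (q.2, q.1.2))) ⁻¹' upperRegion x) := by
    rintro ⟨⟨u, c⟩, b⟩ ⟨-, -, -, -, h⟩
    simp only at h
    simp only [Vpoly, Itilde1]
    rw [abs_of_nonneg (by linarith)]
    ring
  rw [setIntegral_congr_fun (measurePreserving_shear_fst.measurable (measurableSet_upperRegion x))
    hcongr, hset]
  rw [setIntegral_iterated hx1.le (g := fun u => 3 * ((1 - 3 * u) / 4))
    (h := fun p => 1 - 3 * p.1 - 4 * (p.2 / 3)) (by fun_prop) (by fun_prop)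
    (fun u hu => by linarith [hu.2]) (fun p _ _ hp => by linarith) (by fun_prop)
    (F := fun p => x / 1024 * (p.1 - x) ^ 2 * (p.2 / 3 * (p.1 + p.2 / 3)) *
      innerPrimitive (p.1 + p.2 / 3) (p.2 / 3) (1 - 3 * p.1 - 4 * (p.2 / 3)))
    ((by fun_prop : Continuous _).mul
      (continuous_innerPrimitive (by fun_prop) (by fun_prop) (by fun_prop)))
    (fun p => by simp only [intervalIntegral.integral_const_mul, integral_eq_innerPrimitive])]
  have hslice (u : ℝ) : ∫ c in 0..3 * ((1 - 3 * u) / 4),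
      x / 1024 * (u - x) ^ 2 * (c / 3 * (u + c / 3)) *
        innerPrimitive (u + c / 3) (c / 3) (1 - 3 * u - 4 * (c / 3))
      = x / 3072 * ((1 - 3 * x - (1 - 3 * u)) ^ 2 * sliceWeight (1 - 3 * u)) := by
    have hscale := intervalIntegral.integral_comp_div (a := 0) (b := 3 * ((1 - 3 * u) / 4))
      (fun s => x / 1024 * (u - x) ^ 2 *
        (s * (u + s) * innerPrimitive (u + s) s (1 - 3 * u - 4 * s))) (three_ne_zero (α := ℝ))
    simp only [← mul_assoc] at hscale ⊢
    rw [hscale, zero_div, mul_div_cancel_left₀ _ (three_ne_zero (α := ℝ))]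
    have h := integral_slice (1 - 3 * u)
    rw [show (1 - (1 - 3 * u)) / 3 = u by ring] at h
    simp only [mul_assoc, intervalIntegral.integral_const_mul, smul_eq_mul] at h ⊢
    rw [h]
    ring
  simp only [hslice]
  rw [intervalIntegral.integral_const_mul,
    intervalIntegral.integral_comp_sub_mul (fun w => (1 - 3 * x - w) ^ 2 * sliceWeight w)
      (three_ne_zero (α := ℝ)), smul_eq_mul]
  norm_num
  ring

theorem integral_lowerRegion {x : ℝ} (hx0 : 0 < x) (hx1 : x < 1 / 3) :
    ∫ t in lowerRegion x, Vpoly t * Itilde1 x t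
      = x / 9216 * ∫ w in 0..1 - 3 * x, (1 - 3 * x - w) ^ 2 * sliceWeight w := by
  have hemb : MeasurableEmbedding
      (fun q : (ℝ × ℝ) × ℝ => (q.1.2, (q.2, q.1.1 + 3 * q.1.2))) := by
    refine Continuous.measurableEmbedding (by fun_prop) ?_
    rintro ⟨⟨v, a⟩, b⟩ ⟨⟨v', a'⟩, b'⟩ h
    simp only [Prod.mk.injEq] at h ⊢
    obtain ⟨h1, h2, h3⟩ := h
    exact ⟨⟨by linarith, h1⟩, h2⟩
  rw [← measurePreserving_shear_snd.setIntegral_preimage_emb hemb]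
  have hset : (fun q : (ℝ × ℝ) × ℝ => (q.1.2, (q.2, q.1.1 + 3 * q.1.2))) ⁻¹' lowerRegion x
      = {q | (q.1.1 ∈ Set.Icc (3 * x) 1 ∧ 0 ≤ q.1.2 ∧ q.1.2 ≤ (1 - q.1.1) / 4) ∧
        0 ≤ q.2 ∧ q.2 ≤ 1 - q.1.1 - 4 * q.1.2} := by
    ext ⟨⟨v, a⟩, b⟩
    simp only [lowerRegion, Set.mem_preimage, Set.mem_ofPred_eq, Set.mem_Icc]
    constructor
    · rintro ⟨h1, h2, h3, h4, h5⟩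
      refine ⟨⟨⟨?_, ?_⟩, ?_, ?_⟩, ?_, ?_⟩ <;> linarith
    · rintro ⟨⟨⟨h1, h2⟩, h3, h4⟩, h5, h6⟩
      refine ⟨?_, ?_, ?_, ?_, ?_⟩ <;> linarith
  have hcongr : Set.EqOn
      (fun q : (ℝ × ℝ) × ℝ => Vpoly (q.1.2, (q.2, q.1.1 + 3 * q.1.2))
        * Itilde1 x (q.1.2, (q.2, q.1.1 + 3 * q.1.2)))
      (fun q => x / 9216 * (1 - 3 * x - (1 - q.1.1)) ^ 2 *
        (q.1.2 * ((1 - (1 - q.1.1)) / 3 + q.1.2)) *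
        (q.2 ^ 2 * (2 * ((1 - (1 - q.1.1)) / 3 + q.1.2) + q.2) * (2 * q.1.2 + q.2) *
          (2 * ((1 - (1 - q.1.1)) / 3 + q.1.2) + 2 * q.1.2 + q.2) ^ 2))
      ((fun q : (ℝ × ℝ) × ℝ => (q.1.2, (q.2, q.1.1 + 3 * q.1.2))) ⁻¹' lowerRegion x) := by
    rintro ⟨⟨v, a⟩, b⟩ ⟨-, -, -, -, h⟩
    simp only at h
    simp only [Vpoly, Itilde1]
    rw [abs_of_nonpos (by linarith)]
    ring
  rw [setIntegral_congr_fun (measurePreserving_shear_snd.measurable (measurableSet_lowerRegion x))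
    hcongr, hset]
  rw [setIntegral_iterated (by linarith) (g := fun v => (1 - v) / 4)
    (h := fun p => 1 - p.1 - 4 * p.2) (by fun_prop) (by fun_prop)
    (fun v hv => by linarith [hv.2]) (fun p _ _ hp => by linarith) (by fun_prop)
    (F := fun p => x / 9216 * (1 - 3 * x - (1 - p.1)) ^ 2 *
      (p.2 * ((1 - (1 - p.1)) / 3 + p.2)) *
      innerPrimitive ((1 - (1 - p.1)) / 3 + p.2) p.2 (1 - p.1 - 4 * p.2))
    ((by fun_prop : Continuous _).mul
      (continuous_innerPrimitive (by fun_prop) (by fun_prop) (by fun_prop)))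
    (fun p => by simp only [intervalIntegral.integral_const_mul, integral_eq_innerPrimitive])]
  have hslice (v : ℝ) : ∫ a in 0..(1 - v) / 4,
      x / 9216 * (1 - 3 * x - (1 - v)) ^ 2 * (a * ((1 - (1 - v)) / 3 + a)) *
        innerPrimitive ((1 - (1 - v)) / 3 + a) a (1 - v - 4 * a)
      = x / 9216 * ((1 - 3 * x - (1 - v)) ^ 2 * sliceWeight (1 - v)) := by
    rw [← integral_slice, ← mul_assoc, ← intervalIntegral.integral_const_mul]
    simp only [mul_assoc]
  simp only [hslice]
  rw [intervalIntegral.integral_const_mul,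
    intervalIntegral.integral_comp_sub_left (fun w => (1 - 3 * x - w) ^ 2 * sliceWeight w),
    sub_self]

theorem integral_M1 (x : ℝ) (hx0 : 0 < x) (hx1 : x < 1 / 3) :
    (1 / 12 : ℝ) * ∫ t in Rregion1 x, Vpoly t * Itilde1 x t
      = x * (3 * x - 1) ^ 9
          * (567 * x ^ 4 - 3564 * x ^ 3 + 5526 * x ^ 2 - 3152 * x - 1345)
          / 387370509926400 := by
  rw [integral_sum_regions hx0, integral_upperRegion hx0 hx1, integral_lowerRegion hx0 hx1,
    integral_outer]
  ring
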